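/- arXiv:1009.3219 — 4 statements merged into one kernel-verified Lean document; each statement's English description precedes it below -/
import Mathlib

section
/- Let L be a field, G ∈ L[[x]][Y], and s ∈ L[[x]] such that G′(s), the evaluation at s of the formal Y-derivative of G, is a unit of L[[x]]. Define the Newton–Raphson iterate s′ = s − G(s)·G′(s)⁻¹. Then ord(G(s′)) ≥ 2·ord(G(s)), where ord denotes the x-adic order of a power series with the convention ord(0) = ∞. In particular, if ord(G(s)) ≥ 1 then ord(G(s′)) ≥ ord(G(s)) + 1, so each Newton–Raphson step strictly increases the order of the error. -/
/-- If `u` is an inverse of `f′(x)`, then `f(x)²` divides `f(x - f(x) * u)`. -/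
theorem Polynomial.eval_sq_dvd_eval_sub_mul {R : Type*} [CommRing R] (f : Polynomial R) {x u : R}
    (hu : eval x (derivative f) * u = 1) :
    eval x f ^ 2 ∣ eval (x - eval x f * u) f := by
  obtain ⟨k, hk⟩ := f.binomExpansion x (-(eval x f * u))
  refine ⟨k * u ^ 2, ?_⟩
  rw [sub_eq_add_neg, hk]
  linear_combination (-eval x f) * hu

/-- The Newton–Raphson order-increase claim of Remark 2.6: if `G′(s)` is a unit of `L[[x]]`,
then the Newton–Raphson iterate `s′ = s − G(s)·G′(s)⁻¹` satisfies
`ord(G(s′)) ≥ 2·ord(G(s))`; in particular, if `ord(G(s)) ≥ 1`, then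
`ord(G(s′)) ≥ ord(G(s)) + 1`. -/
theorem newton_raphson_order_increase {L : Type*} [Field L]
    (G : Polynomial (PowerSeries L)) (s : PowerSeries L)
    (hunit : IsUnit (Polynomial.eval s (Polynomial.derivative G))) :
    2 * PowerSeries.order (Polynomial.eval s G) ≤
      PowerSeries.order (Polynomial.eval
        (s - Polynomial.eval s G * (Polynomial.eval s (Polynomial.derivative G))⁻¹) G) ∧
    (1 ≤ PowerSeries.order (Polynomial.eval s G) →
      PowerSeries.order (Polynomial.eval s G) + 1 ≤
        PowerSeries.order (Polynomial.eval
          (s - Polynomial.eval s G * (Polynomial.eval s (Polynomial.derivative G))⁻¹) G)) := by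
  have hinv := PowerSeries.mul_inv_cancel _
    (hunit.map (PowerSeries.constantCoeff (R := L))).ne_zero
  obtain ⟨c, hc⟩ := Polynomial.eval_sq_dvd_eval_sub_mul G hinv
  have hmain : 2 * PowerSeries.order (Polynomial.eval s G) ≤
      PowerSeries.order (Polynomial.eval
        (s - Polynomial.eval s G * (Polynomial.eval s (Polynomial.derivative G))⁻¹) G) := by
    rw [hc, PowerSeries.order_mul, PowerSeries.order_pow, nsmul_eq_mul]
    exact le_self_add
  refine ⟨hmain, fun h => le_trans ?_ hmain⟩
  rw [two_mul]
  gcongr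
end

section
/- Let P ∈ ℝ[x,y] be a nonzero polynomial of total degree m ≥ 1 and Z(P) = {p ∈ ℝ² : P(p) = 0}. Then Z(P) has at most m distinct asymptotes. -/
/-- The real zero set of a polynomial `P ∈ ℝ[x,y]`. -/
def Zset (P : MvPolynomial (Fin 2) ℝ) : Set (ℝ × ℝ) :=
  {p : ℝ × ℝ | MvPolynomial.eval ![p.1, p.2] P = 0}

/-- A line `ℓ ⊆ ℝ²` is an asymptote of `Z(P)` if there is a sequence of points of `Z(P)`
whose norms tend to infinity and whose distances to `ℓ` tend to zero. -/
def IsAsymptote (P : MvPolynomial (Fin 2) ℝ) (ℓ : Set (ℝ × ℝ)) : Prop :=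
  (∃ a b t : ℝ, (a, b) ≠ (0, 0) ∧ ℓ = {p : ℝ × ℝ | a * p.1 + b * p.2 = t}) ∧
  ∃ u : ℕ → ℝ × ℝ, (∀ n, u n ∈ Zset P) ∧
    Filter.Tendsto (fun n => ‖u n‖) Filter.atTop Filter.atTop ∧
    Filter.Tendsto (fun n => Metric.infDist (u n) ℓ) Filter.atTop (nhds 0)

open Polynomial in
/-- The substitution `(X, T) ↦ (X, T * X)` on `ℝ[T][X]`: the power of `X` records total degree. -/
noncomputable def blowup : ℝ[X][X] →+* ℝ[X][X] :=
  Polynomial.eval₂RingHom (Polynomial.eval₂RingHom (C.comp C) (C X * X)) X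

open Polynomial in
theorem coeff_coeff_blowup (R : ℝ[X][X]) (k j : ℕ) :
    ((blowup R).coeff k).coeff j = if j ≤ k then (R.coeff (k - j)).coeff j else 0 := by
  induction R using Polynomial.induction_on' with
  | add p q hp hq =>
    simp only [map_add, coeff_add, hp, hq]
    split_ifs <;> simp
  | monomial n c =>
    induction c using Polynomial.induction_on' with
    | add p q hp hq =>
      simp only [map_add, coeff_add, hp, hq]
      split_ifs <;> simp
    | monomial l a =>
      have h : blowup (monomial n (monomial l a)) = monomial (n + l) (monomial l a) := by
        rw [blowup, coe_eval₂RingHom, eval₂_monomial, coe_eval₂RingHom, eval₂_monomial]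
        simp only [RingHom.comp_apply, ← C_mul_X_pow_eq_monomial, map_mul, map_pow]
        ring
      rw [h]
      simp only [coeff_monomial]
      split_ifs <;> simp_all [coeff_monomial] <;> omega

open Polynomial in
/-- `P(X, sX + T)` as a polynomial in `X` over `ℝ[T]`. -/
noncomputable def shearPoly (P : MvPolynomial (Fin 2) ℝ) (s : ℝ) : ℝ[X][X] :=
  MvPolynomial.aeval ![X, C (C s) * X + C X] P

open Polynomial in
/-- `P(T, X)` as a polynomial in `X` over `ℝ[T]`. -/
noncomputable def swapPoly (P : MvPolynomial (Fin 2) ℝ) : ℝ[X][X] :=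
  MvPolynomial.aeval ![C X, X] P

open Polynomial in
/-- The dehomogenized top form of `P`, when `m` is its total degree. -/
noncomputable def topPoly (P : MvPolynomial (Fin 2) ℝ) (m : ℕ) : ℝ[X] :=
  (blowup (shearPoly P 0)).coeff m

open Polynomial in
theorem coeff_coeff_shearPoly_zero (P : MvPolynomial (Fin 2) ℝ) (i j : ℕ) :
    ((shearPoly P 0).coeff i).coeff j =
      P.coeff (Finsupp.single 0 i + Finsupp.single 1 j) := by
  induction P using MvPolynomial.induction_on' with
  | add p q hp hq => simp_all [shearPoly]
  | monomial u a =>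
    have h : shearPoly (MvPolynomial.monomial u a) 0 = monomial (u 0) (monomial (u 1) a) := by
      simp only [shearPoly, MvPolynomial.aeval_monomial, ← C_mul_X_pow_eq_monomial]
      simp [Finsupp.prod_fintype, mul_comm, mul_left_comm]
    have hu : u = Finsupp.single 0 i + Finsupp.single 1 j ↔ u 0 = i ∧ u 1 = j := by
      simp [Finsupp.ext_iff, Fin.forall_fin_two]
    rw [h, MvPolynomial.coeff_monomial]
    simp only [coeff_monomial, hu]
    split_ifs <;> simp_all [coeff_monomial]

open Polynomial in
theorem coeff_coeff_swapPoly (P : MvPolynomial (Fin 2) ℝ) (i j : ℕ) :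
    ((swapPoly P).coeff i).coeff j = ((shearPoly P 0).coeff j).coeff i := by
  rw [coeff_coeff_shearPoly_zero]
  induction P using MvPolynomial.induction_on' with
  | add p q hp hq => simp_all [swapPoly]
  | monomial u a =>
    have h : swapPoly (MvPolynomial.monomial u a) = monomial (u 1) (monomial (u 0) a) := by
      simp only [swapPoly, MvPolynomial.aeval_monomial, ← C_mul_X_pow_eq_monomial]
      simp [Finsupp.prod_fintype, mul_comm, mul_left_comm]
    have hu : u = Finsupp.single 0 j + Finsupp.single 1 i ↔ u 0 = j ∧ u 1 = i := by
      simp [Finsupp.ext_iff, Fin.forall_fin_two]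
    rw [h, MvPolynomial.coeff_monomial]
    simp only [coeff_monomial, hu]
    split_ifs <;> simp_all [coeff_monomial]

open Polynomial in
theorem blowup_shearPoly (P : MvPolynomial (Fin 2) ℝ) (s : ℝ) :
    blowup (shearPoly P s) = (blowup (shearPoly P 0)).map (compRingHom (X + C s)) := by
  induction P using MvPolynomial.induction_on with
  | C a => simp [shearPoly, blowup]
  | add p q hp hq => simp_all [shearPoly]
  | mul_X p i hp =>
    have hi : blowup (shearPoly (MvPolynomial.X i) s) =
        (blowup (shearPoly (MvPolynomial.X i) 0)).map (compRingHom (X + C s)) := by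
      fin_cases i <;> simp [shearPoly, blowup]
      ring
    simp only [shearPoly, map_mul, Polynomial.map_mul] at *
    rw [hp, hi]

open Polynomial in
theorem coeff_coeff_shearPoly_zero_eq_zero (P : MvPolynomial (Fin 2) ℝ) {i j : ℕ}
    (h : P.totalDegree < i + j) : ((shearPoly P 0).coeff i).coeff j = 0 := by
  rw [coeff_coeff_shearPoly_zero]
  apply MvPolynomial.coeff_eq_zero_of_totalDegree_lt
  refine h.trans_eq ?_
  change _ = (Finsupp.single 0 i + Finsupp.single 1 j : Fin 2 →₀ ℕ).degree
  simp [Finsupp.degree_eq_sum]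

open Polynomial in
theorem coeff_blowup_shearPoly (P : MvPolynomial (Fin 2) ℝ) (s : ℝ) {k : ℕ}
    (h : P.totalDegree < k) : (blowup (shearPoly P s)).coeff k = 0 := by
  have h0 : (blowup (shearPoly P 0)).coeff k = 0 := by
    ext j
    rw [coeff_coeff_blowup]
    split_ifs with hj
    · simp [coeff_coeff_shearPoly_zero_eq_zero P (i := k - j) (j := j) (by omega)]
    · simp
  rw [blowup_shearPoly, coeff_map, h0, map_zero]

open Polynomial in
theorem coeff_coeff_shearPoly_eq_zero (P : MvPolynomial (Fin 2) ℝ) (s : ℝ) {i j : ℕ}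
    (h : P.totalDegree < i + j) : ((shearPoly P s).coeff i).coeff j = 0 := by
  have := coeff_coeff_blowup (shearPoly P s) (i + j) j
  simpa [coeff_blowup_shearPoly P s h] using this.symm

open Polynomial in
theorem topPoly_ne_zero {P : MvPolynomial (Fin 2) ℝ} (hP : P ≠ 0) :
    topPoly P P.totalDegree ≠ 0 := by
  obtain ⟨u, hu, hdeg⟩ := Finset.exists_mem_eq_sup P.support
    (MvPolynomial.support_nonempty.mpr hP) (fun s => s.sum fun _ e => e)
  have hd : P.totalDegree = u 0 + u 1 := by
    rw [MvPolynomial.totalDegree, hdeg, Finsupp.sum_fintype _ _ (by simp)]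
    simp
  have hu' : u = Finsupp.single 0 (u 0) + Finsupp.single 1 (u 1) := by
    simp [Finsupp.ext_iff, Fin.forall_fin_two]
  intro h0
  have := coeff_coeff_blowup (shearPoly P 0) P.totalDegree (u 1)
  rw [← topPoly, h0, hd, if_pos (by omega), Nat.add_sub_cancel,
    coeff_coeff_shearPoly_zero, ← hu'] at this
  exact MvPolynomial.mem_support_iff.mp hu (by simpa using this.symm)

open Polynomial in
theorem shearPoly_ne_zero {P : MvPolynomial (Fin 2) ℝ} (hP : P ≠ 0) (s : ℝ) :
    shearPoly P s ≠ 0 := by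
  intro h
  have h1 := congrArg (fun R => R.coeff P.totalDegree) (blowup_shearPoly P s)
  simp only [h, map_zero, coeff_zero, coeff_map, coe_compRingHom_apply] at h1
  refine topPoly_ne_zero hP (Polynomial.ext fun n => ?_)
  have h2 := congrArg (fun p => p.comp (X - C s)) h1
  simp only [comp_assoc, zero_comp, add_comp, X_comp, C_comp, sub_add_cancel, comp_X] at h2
  rw [topPoly, ← h2]

open Polynomial in
theorem card_roots_leadingCoeff_shearPoly_le {P : MvPolynomial (Fin 2) ℝ} (hP : P ≠ 0) (s : ℝ) :
    (shearPoly P s).leadingCoeff.roots.toFinset.card ≤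
      (topPoly P P.totalDegree).rootMultiplicity s := by
  set R := shearPoly P s with hR
  have h1 : R.leadingCoeff.natDegree ≤ P.totalDegree - R.natDegree := by
    refine natDegree_le_iff_coeff_eq_zero.mpr fun j hj => ?_
    exact coeff_coeff_shearPoly_eq_zero P s (by omega)
  have h2 : (X : ℝ[X]) ^ (P.totalDegree - R.natDegree) ∣
      (topPoly P P.totalDegree).comp (X + C s) := by
    rw [X_pow_dvd_iff]
    intro j hj
    have h3 := coeff_coeff_blowup R P.totalDegree j
    rw [if_pos (by omega), coeff_eq_zero_of_natDegree_lt (show R.natDegree < _ by omega),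
      hR, blowup_shearPoly, coeff_map] at h3
    simpa [topPoly] using h3
  have h4 : (X - C s) ^ (P.totalDegree - R.natDegree) ∣ topPoly P P.totalDegree := by
    have := map_dvd (compRingHom (X - C s)) h2
    simpa [comp_assoc] using this
  calc R.leadingCoeff.roots.toFinset.card ≤ R.leadingCoeff.roots.card :=
        Multiset.toFinset_card_le _
    _ ≤ R.leadingCoeff.natDegree := card_roots' _
    _ ≤ _ := h1.trans ((le_rootMultiplicity_iff (topPoly_ne_zero hP)).mpr h4)

open Polynomial in
theorem card_roots_leadingCoeff_swapPoly_add_le (P : MvPolynomial (Fin 2) ℝ) :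
    (swapPoly P).leadingCoeff.roots.toFinset.card + (topPoly P P.totalDegree).natDegree ≤
      P.totalDegree := by
  have h1 : (swapPoly P).leadingCoeff.natDegree ≤ P.totalDegree - (swapPoly P).natDegree := by
    refine natDegree_le_iff_coeff_eq_zero.mpr fun j hj => ?_
    rw [leadingCoeff, coeff_coeff_swapPoly]
    exact coeff_coeff_shearPoly_eq_zero P 0 (by omega)
  have h2 : (topPoly P P.totalDegree).natDegree ≤ min (swapPoly P).natDegree P.totalDegree := by
    refine natDegree_le_iff_coeff_eq_zero.mpr fun j hj => ?_
    rw [topPoly, coeff_coeff_blowup]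
    split_ifs with h
    · have hj' : (swapPoly P).natDegree < j := by omega
      rw [← coeff_coeff_swapPoly, coeff_eq_zero_of_natDegree_lt hj', coeff_zero]
    · rfl
  have h3 : (swapPoly P).leadingCoeff.roots.toFinset.card ≤ (swapPoly P).leadingCoeff.natDegree :=
    (Multiset.toFinset_card_le _).trans (card_roots' _)
  omega

open Polynomial in
theorem swapPoly_ne_zero {P : MvPolynomial (Fin 2) ℝ} (hP : P ≠ 0) : swapPoly P ≠ 0 := by
  intro h
  refine shearPoly_ne_zero hP 0 (Polynomial.ext fun i => Polynomial.ext fun j => ?_)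
  simp [← coeff_coeff_swapPoly, h]

open Polynomial in
theorem eval_shearPoly (P : MvPolynomial (Fin 2) ℝ) (s x t : ℝ) :
    ((shearPoly P s).map (evalRingHom t)).eval x = MvPolynomial.eval ![x, s * x + t] P := by
  induction P using MvPolynomial.induction_on with
  | C a => simp [shearPoly]
  | add p q hp hq => simp_all [shearPoly]
  | mul_X p i hp =>
    simp only [shearPoly, map_mul, Polynomial.map_mul, eval_mul] at *
    rw [hp]
    fin_cases i <;> simp

open Polynomial in
theorem eval_swapPoly (P : MvPolynomial (Fin 2) ℝ) (x t : ℝ) :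
    ((swapPoly P).map (evalRingHom t)).eval x = MvPolynomial.eval ![t, x] P := by
  induction P using MvPolynomial.induction_on with
  | C a => simp [swapPoly]
  | add p q hp hq => simp_all [swapPoly]
  | mul_X p i hp =>
    simp only [swapPoly, map_mul, Polynomial.map_mul, eval_mul] at *
    rw [hp]
    fin_cases i <;> simp

open Polynomial Filter Topology in
theorem leadingCoeff_isRoot_of_tendsto {R : ℝ[X][X]} {x τ : ℕ → ℝ} {t : ℝ}
    (hzero : ∀ n, (R.map (evalRingHom (τ n))).eval (x n) = 0)
    (hx : Tendsto (fun n => |x n|) atTop atTop) (hτ : Tendsto τ atTop (𝓝 t)) :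
    R.leadingCoeff.IsRoot t := by
  have hinv : Tendsto (fun n => (x n)⁻¹) atTop (𝓝 0) := by
    rw [tendsto_zero_iff_abs_tendsto_zero]
    simpa [Function.comp_def, abs_inv] using tendsto_inv_atTop_zero.comp hx
  have hlim : Tendsto (fun n => ∑ i ∈ Finset.range (R.natDegree + 1),
      (R.coeff i).eval (τ n) * (x n)⁻¹ ^ (R.natDegree - i)) atTop
      (𝓝 (∑ i ∈ Finset.range (R.natDegree + 1),
        (R.coeff i).eval t * 0 ^ (R.natDegree - i))) :=
    tendsto_finsetSum _ fun i _ =>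
      (((R.coeff i).continuous.tendsto t).comp hτ).mul (hinv.pow _)
  have hsum : ∑ i ∈ Finset.range (R.natDegree + 1),
      (R.coeff i).eval t * 0 ^ (R.natDegree - i) = R.leadingCoeff.eval t := by
    rw [Finset.sum_range_succ, Finset.sum_eq_zero]
    · simp
    · intro i hi
      have := Finset.mem_range.mp hi
      rw [zero_pow (by omega), mul_zero]
  rw [hsum] at hlim
  refine tendsto_nhds_unique hlim (tendsto_const_nhds.congr' ?_)
  filter_upwards [hx.eventually_gt_atTop 0] with n hn
  have hx0 : x n ≠ 0 := abs_pos.mp hn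
  have h := hzero n
  rw [eval_map, eval₂_eq_sum_range] at h
  rw [← zero_mul ((x n)⁻¹ ^ R.natDegree), ← h, Finset.sum_mul]
  refine Finset.sum_congr rfl fun i hi => ?_
  have hi' : i ≤ R.natDegree := Nat.lt_succ_iff.mp (Finset.mem_range.mp hi)
  obtain ⟨k, hk⟩ := Nat.exists_eq_add_of_le hi'
  rw [hk, Nat.add_sub_cancel_left, pow_add]
  rw [coe_evalRingHom, mul_assoc, ← mul_assoc (x n ^ i), ← mul_pow, mul_inv_cancel₀ hx0, one_pow,
    one_mul]

theorem abs_sub_le_mul_infDist_line {a b t : ℝ} (hab : (a, b) ≠ (0, 0)) (p : ℝ × ℝ) :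
    |a * p.1 + b * p.2 - t| ≤
      (|a| + |b|) * Metric.infDist p {q : ℝ × ℝ | a * q.1 + b * q.2 = t} := by
  have hpos : 0 < |a| + |b| := by
    by_contra! h
    have ha := abs_nonneg a
    have hb := abs_nonneg b
    exact hab (Prod.ext (abs_eq_zero.mp (by linarith)) (abs_eq_zero.mp (by linarith)))
  have hne : {q : ℝ × ℝ | a * q.1 + b * q.2 = t}.Nonempty := by
    by_cases ha : a = 0
    · have hb : b ≠ 0 := by rintro rfl; exact hab (by rw [ha])
      exact ⟨(0, t / b), by simp [mul_div_cancel₀ _ hb]⟩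
    · exact ⟨(t / a, 0), by simp [mul_div_cancel₀ _ ha]⟩
  rw [← div_le_iff₀' hpos]
  refine (Metric.le_infDist hne).mpr fun q hq => ?_
  rw [div_le_iff₀' hpos]
  have hq' : a * q.1 + b * q.2 = t := hq
  have h1 : |p.1 - q.1| ≤ dist p q := le_max_left _ _
  have h2 : |p.2 - q.2| ≤ dist p q := le_max_right _ _
  calc |a * p.1 + b * p.2 - t| = |a * (p.1 - q.1) + b * (p.2 - q.2)| := by
        rw [← hq']; ring_nf
    _ ≤ |a| * |p.1 - q.1| + |b| * |p.2 - q.2| := by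
        rw [← abs_mul, ← abs_mul]; exact abs_add_le _ _
    _ ≤ (|a| + |b|) * dist p q := by
        rw [add_mul]; gcongr

open Filter Topology in
theorem tendsto_of_infDist_line_tendsto_zero {a b t : ℝ} (hab : (a, b) ≠ (0, 0))
    {u : ℕ → ℝ × ℝ}
    (hu : Tendsto (fun n => Metric.infDist (u n) {q : ℝ × ℝ | a * q.1 + b * q.2 = t})
      atTop (𝓝 0)) :
    Tendsto (fun n => a * (u n).1 + b * (u n).2) atTop (𝓝 t) := by
  rw [tendsto_iff_dist_tendsto_zero]
  refine squeeze_zero (fun _ => dist_nonneg) (fun n => abs_sub_le_mul_infDist_line hab (u n)) ?_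
  simpa using hu.const_mul (|a| + |b|)

open Filter Topology in
theorem tendsto_abs_fst_atTop {u : ℕ → ℝ × ℝ} {s t : ℝ}
    (hnorm : Tendsto (fun n => ‖u n‖) atTop atTop)
    (ht : Tendsto (fun n => (u n).2 - s * (u n).1) atTop (𝓝 t)) :
    Tendsto (fun n => |(u n).1|) atTop atTop := by
  have hpos : 0 < 1 + |s| := by positivity
  have h1 : Tendsto (fun n => (‖u n‖ + -|(u n).2 - s * (u n).1|) / (1 + |s|)) atTop atTop :=
    (hnorm.atTop_add ht.abs.neg).atTop_div_const hpos
  refine tendsto_atTop_mono (fun n => ?_) h1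
  rw [div_le_iff₀ hpos]
  have h2 : |(u n).2| ≤ |(u n).2 - s * (u n).1| + |s| * |(u n).1| := by
    rw [← abs_mul]
    simpa using abs_add_le ((u n).2 - s * (u n).1) (s * (u n).1)
  have h3 : ‖u n‖ ≤ |(u n).1| + |s| * |(u n).1| + |(u n).2 - s * (u n).1| := by
    refine max_le ?_ ?_ <;> simp only [Real.norm_eq_abs]
    · have : 0 ≤ |s| * |(u n).1| := by positivity
      linarith [abs_nonneg ((u n).2 - s * (u n).1)]
    · linarith [abs_nonneg (u n).1]
  linarith

/-- The line of slope `s` and intercept `t`. -/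
def slopeLine (s t : ℝ) : Set (ℝ × ℝ) := {p | p.2 = s * p.1 + t}

/-- The vertical line of abscissa `t`. -/
def verticalLine (t : ℝ) : Set (ℝ × ℝ) := {p | p.1 = t}

open Filter Topology in
theorem IsAsymptote.exists_isRoot {P : MvPolynomial (Fin 2) ℝ} {ℓ : Set (ℝ × ℝ)}
    (h : IsAsymptote P ℓ) :
    (∃ s t, ℓ = slopeLine s t ∧ (shearPoly P s).leadingCoeff.IsRoot t) ∨
      ∃ t, ℓ = verticalLine t ∧ (swapPoly P).leadingCoeff.IsRoot t := by
  obtain ⟨⟨a, b, c, hab, rfl⟩, u, hu, hnorm, hdist⟩ := h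
  have hlim := tendsto_of_infDist_line_tendsto_zero hab hdist
  by_cases hb : b = 0
  · subst hb
    have ha : a ≠ 0 := by rintro rfl; exact hab rfl
    have hx : Tendsto (fun n => (u n).1) atTop (𝓝 (c / a)) := by
      simpa [mul_div_cancel_left₀ _ ha] using hlim.div_const a
    have hy : Tendsto (fun n => |(u n).2|) atTop atTop := by
      refine tendsto_abs_fst_atTop (u := fun n => (u n).swap) (s := 0) (t := c / a) ?_ (by simpa)
      simpa [Prod.norm_def, max_comm] using hnorm
    refine Or.inr ⟨c / a, ?_, leadingCoeff_isRoot_of_tendsto (fun n => ?_) hy hx⟩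
    · ext p
      simp [verticalLine, eq_div_iff ha, mul_comm]
    · rw [eval_swapPoly]
      exact hu n
  · have ht : Tendsto (fun n => (u n).2 - -a / b * (u n).1) atTop (𝓝 (c / b)) := by
      refine (hlim.div_const b).congr fun n => ?_
      field_simp
      ring
    have hx := tendsto_abs_fst_atTop hnorm ht
    refine Or.inl ⟨-a / b, c / b, ?_, leadingCoeff_isRoot_of_tendsto (fun n => ?_) hx ht⟩
    · ext p
      simp only [slopeLine, Set.mem_ofPred_eq]
      field_simp
      constructor <;> intro h <;> linarith
    · rw [eval_shearPoly, add_sub_cancel]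
      exact hu n

/-- The bound `r₃ ≤ m` of Lemma 2.2: a real plane algebraic curve of degree `m ≥ 1` has
at most `m` distinct asymptotes. -/
theorem at_most_m_asymptotes (P : MvPolynomial (Fin 2) ℝ) (m : ℕ)
    (hP : P ≠ 0) (hdeg : P.totalDegree = m) (hm : 1 ≤ m) :
    {ℓ : Set (ℝ × ℝ) | IsAsymptote P ℓ}.Finite ∧
    {ℓ : Set (ℝ × ℝ) | IsAsymptote P ℓ}.ncard ≤ m := by
  classical
  subst hdeg
  set q := topPoly P P.totalDegree with hq
  have hq0 : q ≠ 0 := topPoly_ne_zero hP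
  let F : Finset (Set (ℝ × ℝ)) :=
    (q.roots.toFinset.biUnion fun s =>
      (shearPoly P s).leadingCoeff.roots.toFinset.image (slopeLine s)) ∪
    (swapPoly P).leadingCoeff.roots.toFinset.image verticalLine
  have hsub : {ℓ : Set (ℝ × ℝ) | IsAsymptote P ℓ} ⊆ F := by
    intro ℓ hℓ
    rcases IsAsymptote.exists_isRoot hℓ with ⟨s, t, rfl, hroot⟩ | ⟨t, rfl, hroot⟩
    · have ht : t ∈ (shearPoly P s).leadingCoeff.roots.toFinset := by
        simpa [shearPoly_ne_zero hP s] using hroot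
      have hs : s ∈ q.roots.toFinset := by
        rw [Multiset.mem_toFinset, ← Multiset.count_pos, Polynomial.count_roots]
        exact (Finset.card_pos.mpr ⟨t, ht⟩).trans_le (card_roots_leadingCoeff_shearPoly_le hP s)
      exact Finset.mem_union_left _
        (Finset.mem_biUnion.mpr ⟨s, hs, Finset.mem_image_of_mem _ ht⟩)
    · have ht : t ∈ (swapPoly P).leadingCoeff.roots.toFinset := by
        simpa [swapPoly_ne_zero hP] using hroot
      exact Finset.mem_union_right _ (Finset.mem_image_of_mem _ ht)
  have hslope : (q.roots.toFinset.biUnion fun s =>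
      (shearPoly P s).leadingCoeff.roots.toFinset.image (slopeLine s)).card ≤ q.natDegree := by
    calc _ ≤ ∑ s ∈ q.roots.toFinset, q.roots.count s := by
          refine Finset.card_biUnion_le.trans (Finset.sum_le_sum fun s _ => ?_)
          rw [Polynomial.count_roots]
          exact Finset.card_image_le.trans (card_roots_leadingCoeff_shearPoly_le hP s)
      _ = q.roots.card := Multiset.toFinset_sum_count_eq _
      _ ≤ q.natDegree := q.card_roots'
  have hcard : F.card ≤ P.totalDegree := by
    have h1 := card_roots_leadingCoeff_swapPoly_add_le P
    rw [← hq] at h1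
    have h2 : ((swapPoly P).leadingCoeff.roots.toFinset.image verticalLine).card ≤ _ :=
      Finset.card_image_le
    have h3 : F.card ≤ _ := Finset.card_union_le _ _
    omega
  refine ⟨F.finite_toSet.subset hsub, ?_⟩
  exact (Set.ncard_le_ncard hsub F.finite_toSet).trans (by rwa [Set.ncard_coe_finset])
end

section
/- Let P ∈ ℝ[x,y] be a nonzero polynomial of total degree m ≥ 1, with homogeneous decomposition P = Σ_{k=0}^m P_k where P_k is homogeneous of degree k. Let (a,b) ∈ ℝ² with (a,b) ≠ (0,0) and t ∈ ℝ, and suppose the line ℓ = {(x,y) : ax + by = t} is an asymptote of Z(P). Then P_m(b, −a) = 0; equivalently, the linear form aX + bY divides the top-degree form P_m in ℝ[X,Y]. -/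
open Filter Topology

namespace MvPolynomial

theorem IsHomogeneous.aeval_smul {σ R A : Type*} [CommSemiring R] [CommSemiring A] [Algebra R A]
    {φ : MvPolynomial σ R} {n : ℕ} (hφ : φ.IsHomogeneous n) (c : A) (g : σ → A) :
    MvPolynomial.aeval (c • g) φ = c ^ n * MvPolynomial.aeval g φ := by
  rw [aeval_def, aeval_def, eval₂_eq, eval₂_eq, Finset.mul_sum]
  refine Finset.sum_congr rfl fun d hd => ?_
  have hn : n = ∑ i ∈ d.support, d i := hφ.degree_eq_sum_deg_support hd
  simp only [Pi.smul_apply, smul_eq_mul, mul_pow, Finset.prod_mul_distrib]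
  rw [Finset.prod_pow_eq_pow_sum, ← hn]
  ring

theorem IsHomogeneous.eval_smul {σ R : Type*} [CommSemiring R]
    {φ : MvPolynomial σ R} {n : ℕ} (hφ : φ.IsHomogeneous n) (c : R) (g : σ → R) :
    eval (c • g) φ = c ^ n * eval g φ := by
  simpa only [aeval_eq_eval] using hφ.aeval_smul c g

/-- The top form of a polynomial vanishes at every limit of rescaled zeros, when the scaling
factors tend to zero. -/
theorem eval_homogeneousComponent_totalDegree_eq_zero {σ ι : Type*} {l : Filter ι} [l.NeBot]
    (P : MvPolynomial σ ℝ) {x : ι → σ → ℝ} {r : ι → ℝ} {v : σ → ℝ}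
    (hx : ∀ i, eval (x i) P = 0) (hr : Tendsto r l (𝓝 0))
    (hv : Tendsto (fun i => r i • x i) l (𝓝 v)) :
    eval v (homogeneousComponent P.totalDegree P) = 0 := by
  have hsum (i : ι) : ∑ k ∈ Finset.range (P.totalDegree + 1),
      r i ^ (P.totalDegree - k) * eval (r i • x i) (homogeneousComponent k P) = 0 := by
    calc
      _ = ∑ k ∈ Finset.range (P.totalDegree + 1),
          r i ^ P.totalDegree * eval (x i) (homogeneousComponent k P) := by
        refine Finset.sum_congr rfl fun k hk => ?_
        rw [(homogeneousComponent_isHomogeneous k P).eval_smul, ← mul_assoc, ← pow_add,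
          Nat.sub_add_cancel (Nat.lt_succ_iff.mp (Finset.mem_range.mp hk))]
      _ = 0 := by
        rw [← Finset.mul_sum, ← map_sum, sum_homogeneousComponent, hx, mul_zero]
  have hlim : Tendsto (fun i => ∑ k ∈ Finset.range (P.totalDegree + 1),
      r i ^ (P.totalDegree - k) * eval (r i • x i) (homogeneousComponent k P)) l
      (𝓝 (∑ k ∈ Finset.range (P.totalDegree + 1),
        0 ^ (P.totalDegree - k) * eval v (homogeneousComponent k P))) :=
    tendsto_finsetSum _ fun k _ => (hr.pow _).mul
      (((continuous_eval (homogeneousComponent k P)).tendsto v).comp hv)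
  simp only [hsum] at hlim
  have h := tendsto_nhds_unique hlim tendsto_const_nhds
  rwa [Finset.sum_range_succ, Finset.sum_eq_zero, zero_add, Nat.sub_self, pow_zero, one_mul] at h
  intro k hk
  rw [zero_pow (Nat.sub_ne_zero_of_lt (Finset.mem_range.mp hk)), zero_mul]

/-- A binary form vanishing at `(b, -a)` is divisible by the linear form `aX + bY`. -/
theorem IsHomogeneous.linear_dvd_of_eval_eq_zero {K : Type*} [Field K]
    {Q : MvPolynomial (Fin 2) K} {n : ℕ} (hQ : Q.IsHomogeneous n) {a b : K}
    (hab : a ≠ 0 ∨ b ≠ 0) (h : eval ![b, -a] Q = 0) :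
    C a * X 0 + C b * X 1 ∣ Q := by
  set L : MvPolynomial (Fin 2) K := C a * X 0 + C b * X 1
  let π := Ideal.Quotient.mkₐ K (Ideal.span {L})
  have hπL : a • π (X 0) + b • π (X 1) = 0 := by
    rw [← map_smul, ← map_smul, ← map_add, smul_eq_C_mul, smul_eq_C_mul]
    exact Ideal.Quotient.eq_zero_iff_mem.mpr (Ideal.mem_span_singleton_self L)
  obtain ⟨s, hs⟩ : ∃ s, (fun i => π (X i)) =
      s • (algebraMap K (MvPolynomial (Fin 2) K ⧸ Ideal.span {L}) ∘ ![b, -a]) := by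
    rcases hab with ha | hb
    · refine ⟨-a⁻¹ • π (X 1), _root_.funext fun i => ?_⟩
      have h0 : π (X 0) = -(a⁻¹ * b) • π (X 1) := by
        rw [neg_smul, mul_smul, eq_neg_iff_add_eq_zero]
        simpa [smul_add, smul_smul, ha] using congrArg (a⁻¹ • ·) hπL
      rw [Pi.smul_apply, Function.comp_apply, smul_eq_mul, mul_comm, ← Algebra.smul_def, smul_smul]
      fin_cases i
      · simpa [mul_comm] using h0
      · simp [ha]
    · refine ⟨b⁻¹ • π (X 0), _root_.funext fun i => ?_⟩
      have h1 : π (X 1) = -(b⁻¹ * a) • π (X 0) := by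
        rw [neg_smul, mul_smul, eq_neg_iff_add_eq_zero, add_comm]
        simpa [smul_add, smul_smul, hb] using congrArg (b⁻¹ • ·) hπL
      rw [Pi.smul_apply, Function.comp_apply, smul_eq_mul, mul_comm, ← Algebra.smul_def, smul_smul]
      fin_cases i
      · simp [hb]
      · simpa [mul_comm] using h1
  have hπQ : π Q = 0 := by
    have hcomp : π Q = MvPolynomial.aeval (fun i => π (X i)) Q := by
      conv_lhs => rw [← aeval_X_left_apply Q]
      rw [← AlgHom.comp_apply, comp_aeval]
    rw [hcomp, hs, hQ.aeval_smul, aeval_algebraMap_apply, aeval_eq_eval, h, map_zero, mul_zero]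
  exact Ideal.mem_span_singleton.mp (Ideal.Quotient.eq_zero_iff_mem.mp hπQ)

end MvPolynomial

/-- Up to a constant, the affine form `ax + by - t` is bounded by the distance to its zero line. -/
theorem abs_linear_sub_le_infDist {a b t : ℝ} (hab : (a, b) ≠ ((0 : ℝ), (0 : ℝ))) (p : ℝ × ℝ) :
    |a * p.1 + b * p.2 - t| ≤
      (|a| + |b|) * Metric.infDist p {q : ℝ × ℝ | a * q.1 + b * q.2 = t} := by
  have hab' : a ≠ 0 ∨ b ≠ 0 := by
    simpa [Prod.ext_iff, imp_iff_not_or] using hab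
  have hM : 0 < |a| + |b| := by
    rcases hab' with h | h
    · have := abs_pos.mpr h; positivity
    · have := abs_pos.mpr h; positivity
  have hne : {q : ℝ × ℝ | a * q.1 + b * q.2 = t}.Nonempty := by
    rcases hab' with h | h
    · exact ⟨(t / a, 0), by simp [mul_div_cancel₀ _ h]⟩
    · exact ⟨(0, t / b), by simp [mul_div_cancel₀ _ h]⟩
  rw [← div_le_iff₀' hM, Metric.le_infDist hne]
  intro q hq
  rw [div_le_iff₀' hM]
  have h1 : |p.1 - q.1| ≤ dist p q := le_max_left _ _
  have h2 : |p.2 - q.2| ≤ dist p q := le_max_right _ _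
  calc |a * p.1 + b * p.2 - t| = |a * (p.1 - q.1) + b * (p.2 - q.2)| := by
        rw [← Set.mem_ofPred_eq.mp hq]; congr 1; ring
    _ ≤ |a| * |p.1 - q.1| + |b| * |p.2 - q.2| := by
        rw [← abs_mul, ← abs_mul]; exact abs_add_le _ _
    _ ≤ (|a| + |b|) * dist p q := by
        rw [add_mul]; gcongr

/-- Nunemacher's theorem, first part (Remark 2.3): every asymptote `{ax + by = t}` of the
curve `Z(P)` arises from a linear factor of the top-degree form `P_m`; that is,
`P_m(b,−a) = 0`, equivalently `aX + bY` divides `P_m`. -/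
theorem asymptote_from_linear_factor_of_top_form
    (P : MvPolynomial (Fin 2) ℝ) (m : ℕ)
    (hP : P ≠ 0) (hdeg : P.totalDegree = m) (hm : 1 ≤ m)
    (a b t : ℝ) (hab : (a, b) ≠ ((0 : ℝ), (0 : ℝ)))
    (hasym : IsAsymptote P {p : ℝ × ℝ | a * p.1 + b * p.2 = t}) :
    MvPolynomial.eval ![b, -a] (MvPolynomial.homogeneousComponent m P) = 0 ∧
    (MvPolynomial.C a * MvPolynomial.X 0 + MvPolynomial.C b * MvPolynomial.X 1) ∣
      MvPolynomial.homogeneousComponent m P := by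
  subst hdeg
  have hab' : a ≠ 0 ∨ b ≠ 0 := by
    simpa [Prod.ext_iff, imp_iff_not_or] using hab
  suffices h : MvPolynomial.eval ![b, -a]
      (MvPolynomial.homogeneousComponent P.totalDegree P) = 0 from
    ⟨h, (MvPolynomial.homogeneousComponent_isHomogeneous _ P).linear_dvd_of_eval_eq_zero hab' h⟩
  obtain ⟨-, u, hu, hnorm, hdist⟩ := hasym
  have hN : 0 < a ^ 2 + b ^ 2 := by
    rcases hab' with h | h <;> positivity
  let c : ℕ → ℝ := fun n => a * (u n).1 + b * (u n).2
  let s : ℕ → ℝ := fun n => b * (u n).1 - a * (u n).2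
  have hc : Tendsto c atTop (𝓝 t) := by
    rw [tendsto_iff_norm_sub_tendsto_zero]
    refine squeeze_zero (fun n => norm_nonneg _) (fun n => abs_linear_sub_le_infDist hab (u n)) ?_
    simpa using hdist.const_mul (|a| + |b|)
  have hx (n : ℕ) : (a ^ 2 + b ^ 2) * (u n).1 = a * c n + b * s n := by simp only [c, s]; ring
  have hy (n : ℕ) : (a ^ 2 + b ^ 2) * (u n).2 = b * c n - a * s n := by simp only [c, s]; ring
  have hs : Tendsto (fun n => ‖s n‖) atTop atTop := by
    have hbound (n : ℕ) : (a ^ 2 + b ^ 2) * ‖u n‖ ≤ (|a| + |b|) * (|c n| + |s n|) := by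
      have ha := abs_nonneg a
      have hb := abs_nonneg b
      have hc' := abs_nonneg (c n)
      have hs' := abs_nonneg (s n)
      rw [Prod.norm_def, mul_max_of_nonneg _ _ hN.le, Real.norm_eq_abs, Real.norm_eq_abs]
      refine max_le ?_ ?_
      · rw [← abs_of_pos hN, ← abs_mul, hx]
        refine (abs_add_le _ _).trans ?_
        rw [abs_mul, abs_mul]
        nlinarith
      · rw [← abs_of_pos hN, ← abs_mul, hy]
        refine (abs_sub _ _).trans ?_
        rw [abs_mul, abs_mul]
        nlinarith
    have hM : 0 < |a| + |b| := by
      rcases hab' with h | h <;> have := abs_pos.mpr h <;> positivity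
    have hsum : Tendsto (fun n => |c n| + |s n|) atTop atTop :=
      tendsto_atTop_mono (fun n => (div_le_iff₀' hM).mpr (hbound n))
        ((hnorm.const_mul_atTop hN).atTop_div_const hM)
    simpa using hsum.atTop_add hc.abs.neg
  have hr : Tendsto (fun n => (s n)⁻¹) atTop (𝓝 0) :=
    tendsto_inv₀_cobounded.comp (tendsto_norm_atTop_iff_cobounded.mp hs)
  have hrs : Tendsto (fun n => (s n)⁻¹ * s n) atTop (𝓝 1) := by
    refine tendsto_const_nhds.congr' ?_
    filter_upwards [hs.eventually_gt_atTop 0] with n hn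
    exact (inv_mul_cancel₀ (norm_pos_iff.mp hn)).symm
  refine P.eval_homogeneousComponent_totalDegree_eq_zero (l := atTop)
    (x := fun n => ![(u n).1, (u n).2]) (r := fun n => (s n)⁻¹ * (a ^ 2 + b ^ 2)) hu
    (by simpa using hr.mul_const (a ^ 2 + b ^ 2)) (tendsto_pi_nhds.mpr fun i => ?_)
  fin_cases i
  · have := ((hr.mul hc).const_mul a).add (hrs.const_mul b)
    simp only [zero_mul, mul_zero, zero_add, mul_one] at this
    refine this.congr fun n => ?_
    simp [mul_assoc, hx]
    ring
  · have := ((hr.mul hc).const_mul b).sub (hrs.const_mul a)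
    simp only [zero_mul, mul_zero, zero_sub, mul_one] at this
    refine this.congr fun n => ?_
    simp [mul_assoc, hy]
    ring
end

section
/- Let K be a field, ℙ³ = ℙ(K⁴), and let ω = ℙ(W) be the hyperplane determined by a 3-dimensional subspace W ⊆ K⁴. Let Q ∈ ω and let C ⊆ ℙ³ be a nonempty subset with Q ∉ C. Then (⋃_{w ∈ C} line(Q,w)) ∩ ω = {Q} ∪ ⋃_{P ∈ C ∩ ω} line(Q,P). In particular, if C ∩ ω = {P₁, …, P_m} is nonempty, then the intersection of the cone over C with vertex Q with the hyperplane ω is exactly the union of the m lines through Q and the points P₁, …, P_m. -/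
/-- The projective line through two points of `ℙ³(K)`: the set of points whose
representative vectors lie in the span of representative vectors of the two points. -/
def projLine {K : Type*} [Field K] (p q : Projectivization K (Fin 4 → K)) :
    Set (Projectivization K (Fin 4 → K)) :=
  {r | r.rep ∈ Submodule.span K {p.rep, q.rep}}

theorem left_mem_projLine {K : Type*} [Field K] (p q : Projectivization K (Fin 4 → K)) :
    p ∈ projLine p q :=
  Submodule.subset_span (by simp)

theorem projLine_rep_mem {K : Type*} [Field K] {W : Submodule K (Fin 4 → K)}
    {p q r : Projectivization K (Fin 4 → K)} (hp : p.rep ∈ W) (hq : q.rep ∈ W)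
    (hr : r ∈ projLine p q) : r.rep ∈ W :=
  Submodule.span_le.2 (Set.insert_subset hp (Set.singleton_subset_iff.2 hq)) hr

/-- A line through a point of `ℙ(W)` meets `ℙ(W)` in that point only, unless the second
point spanning the line is also in `ℙ(W)`. -/
theorem eq_or_rep_mem_of_mem_projLine {K : Type*} [Field K] {W : Submodule K (Fin 4 → K)}
    {p q r : Projectivization K (Fin 4 → K)} (hp : p.rep ∈ W) (hr : r ∈ projLine p q)
    (hrW : r.rep ∈ W) : r = p ∨ q.rep ∈ W := by
  obtain ⟨a, b, hab⟩ := Submodule.mem_span_pair.1 hr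
  by_cases hb : b = 0
  · left
    rw [← r.mk_rep, ← p.mk_rep, Projectivization.mk_eq_mk_iff']
    exact ⟨a, by simpa [hb] using hab⟩
  · right
    rw [← W.smul_mem_iff hb, ← W.add_mem_iff_right (W.smul_mem a hp), hab]
    exact hrW

/-- The degenerate-fibre computation of Lemma 5.14: if the vertex `Q` lies in the
hyperplane `ω = ℙ(W)`, `C` is nonempty and `Q ∉ C`, then the intersection of the cone over
`C` with vertex `Q` with `ω` equals `{Q} ∪ ⋃_{P ∈ C ∩ ω} line(Q,P)`; in particular, if
`C ∩ ω` is nonempty, it is exactly the union of the lines through `Q` and the points of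
`C ∩ ω`. -/
theorem cone_cap_hyperplane_through_vertex {K : Type*} [Field K]
    (W : Submodule K (Fin 4 → K)) (hW : Module.finrank K W = 3)
    (Q : Projectivization K (Fin 4 → K)) (hQ : Q.rep ∈ W)
    (C : Set (Projectivization K (Fin 4 → K))) (hne : C.Nonempty) (hQC : Q ∉ C) :
    ((⋃ w ∈ C, projLine Q w) ∩ {r : Projectivization K (Fin 4 → K) | r.rep ∈ W} =
      {Q} ∪ ⋃ P ∈ C ∩ {r : Projectivization K (Fin 4 → K) | r.rep ∈ W}, projLine Q P) ∧
    ((C ∩ {r : Projectivization K (Fin 4 → K) | r.rep ∈ W}).Nonempty →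
      (⋃ w ∈ C, projLine Q w) ∩ {r : Projectivization K (Fin 4 → K) | r.rep ∈ W} =
        ⋃ P ∈ C ∩ {r : Projectivization K (Fin 4 → K) | r.rep ∈ W}, projLine Q P) := by
  have key : (⋃ w ∈ C, projLine Q w) ∩ {r : Projectivization K (Fin 4 → K) | r.rep ∈ W} =
      {Q} ∪ ⋃ P ∈ C ∩ {r : Projectivization K (Fin 4 → K) | r.rep ∈ W}, projLine Q P := by
    ext r
    simp only [Set.mem_inter_iff, Set.mem_iUnion, Set.mem_union, Set.mem_singleton_iff,
      Set.mem_ofPred_eq, exists_prop]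
    constructor
    · rintro ⟨⟨w, hw, hr⟩, hrW⟩
      exact (eq_or_rep_mem_of_mem_projLine hQ hr hrW).imp_right fun h => ⟨w, ⟨hw, h⟩, hr⟩
    · rintro (rfl | ⟨w, ⟨hw, hwW⟩, hr⟩)
      · obtain ⟨w, hw⟩ := hne
        exact ⟨⟨w, hw, left_mem_projLine r w⟩, hQ⟩
      · exact ⟨⟨w, hw, hr⟩, projLine_rep_mem hQ hwW hr⟩
  refine ⟨key, ?_⟩
  rintro ⟨P, hP⟩
  rw [key]
  exact Set.union_eq_right.2
    (Set.singleton_subset_iff.2 (Set.mem_biUnion hP (left_mem_projLine Q P)))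
end
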